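/- For β_eff > 0 and z = 2·β_eff, the Gibbs probability at inverse temperature β_eff of the set of ground states (minimizers) of the star Hamiltonian equals 1/(1 + e^{−2·z})^l; that is, (Σ_{s ground state} e^{−β_eff·H_star(s)}) / (Σ_s e^{−β_eff·H_star(s)}) = (1 + e^{−4·β_eff})^{−l}. -/

import Mathlib

open scoped Classical
open Finset Real

/-- Spin value of a boolean: `true ↦ +1`, `false ↦ -1`. -/
noncomputable def spin (b : Bool) : ℝ := if b then 1 else -1

/-- The star Hamiltonian
`H_star = (1 + s_c)·(x₁+⋯+x_l) - (1 - s_c)·(y₁+⋯+y_l)` on configurations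
`σ = (s_c, x, y)`. -/
noncomputable def Hstar (l : ℕ) (σ : Bool × (Fin l → Bool) × (Fin l → Bool)) : ℝ :=
  (1 + spin σ.1) * (∑ i, spin (σ.2.1 i)) - (1 - spin σ.1) * (∑ i, spin (σ.2.2 i))

theorem spin_true : spin true = 1 := by simp [spin]

theorem spin_false : spin false = -1 := by simp [spin]

theorem spin_le_one (b : Bool) : spin b ≤ 1 := by
  cases b <;> norm_num [spin]

theorem neg_one_le_spin (b : Bool) : -1 ≤ spin b := by
  cases b <;> norm_num [spin]

theorem Hstar_true {l : ℕ} (x y : Fin l → Bool) : Hstar l (true, x, y) = 2 * ∑ i, spin (x i) := by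
  simp only [Hstar, spin_true]
  ring

theorem Hstar_false {l : ℕ} (x y : Fin l → Bool) :
    Hstar l (false, x, y) = -2 * ∑ i, spin (y i) := by
  simp only [Hstar, spin_false]
  ring

theorem sum_spin_le {l : ℕ} (x : Fin l → Bool) : ∑ i, spin (x i) ≤ l := by
  simpa using Finset.sum_le_sum fun i (_ : i ∈ univ) => spin_le_one (x i)

theorem neg_le_sum_spin {l : ℕ} (x : Fin l → Bool) : -(l : ℝ) ≤ ∑ i, spin (x i) := by
  simpa using Finset.sum_le_sum fun i (_ : i ∈ univ) => neg_one_le_spin (x i)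

theorem sum_spin_eq_iff {l : ℕ} (x : Fin l → Bool) :
    ∑ i, spin (x i) = l ↔ x = fun _ => true := by
  have h := Finset.sum_eq_sum_iff_of_le fun i (_ : i ∈ univ) => spin_le_one (x i)
  simp only [sum_const, card_univ, Fintype.card_fin, nsmul_eq_mul, mul_one] at h
  rw [h, funext_iff]
  refine ⟨fun hx i => ?_, fun hx i _ => by rw [hx i, spin_true]⟩
  have := hx i (mem_univ i)
  cases hi : x i
  · norm_num [hi, spin] at this
  · rfl

theorem sum_spin_eq_neg_iff {l : ℕ} (x : Fin l → Bool) :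
    ∑ i, spin (x i) = -l ↔ x = fun _ => false := by
  have h := Finset.sum_eq_sum_iff_of_le fun i (_ : i ∈ univ) => neg_one_le_spin (x i)
  simp only [sum_const, card_univ, Fintype.card_fin, nsmul_eq_mul, mul_neg, mul_one] at h
  rw [eq_comm, h, funext_iff]
  refine ⟨fun hx i => ?_, fun hx i _ => by rw [hx i, spin_false]⟩
  have := hx i (mem_univ i)
  cases hi : x i
  · rfl
  · norm_num [hi, spin] at this

theorem neg_two_mul_le_Hstar {l : ℕ} (σ : Bool × (Fin l → Bool) × (Fin l → Bool)) :
    -2 * (l : ℝ) ≤ Hstar l σ := by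
  obtain ⟨_ | _, x, y⟩ := σ
  · rw [Hstar_false]
    linarith [sum_spin_le y]
  · rw [Hstar_true]
    linarith [neg_le_sum_spin x]

theorem forall_Hstar_le_iff {l : ℕ} (σ : Bool × (Fin l → Bool) × (Fin l → Bool)) :
    (∀ t, Hstar l σ ≤ Hstar l t) ↔ Hstar l σ = -2 * (l : ℝ) := by
  refine ⟨fun h => le_antisymm ?_ (neg_two_mul_le_Hstar σ), fun h t => h ▸ neg_two_mul_le_Hstar t⟩
  refine (h (true, fun _ => false, fun _ => false)).trans_eq ?_
  rw [Hstar_true, (sum_spin_eq_neg_iff _).2 rfl]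
  ring

theorem sum_exp_mul_sum_spin (l : ℕ) (c : ℝ) :
    ∑ x : Fin l → Bool, exp (c * ∑ i, spin (x i)) = (exp c + exp (-c)) ^ l := by
  simp_rw [Finset.mul_sum, Real.exp_sum]
  rw [← Fintype.piFinset_univ, ← Finset.prod_univ_sum (fun _ => univ) fun _ b => exp (c * spin b)]
  simp [spin]

theorem sum_exp_Hstar (l : ℕ) (β : ℝ) :
    ∑ σ : Bool × (Fin l → Bool) × (Fin l → Bool), exp (-β * Hstar l σ) =
      2 * 2 ^ l * (exp (2 * β) + exp (-(2 * β))) ^ l := by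
  have hx (x : Fin l → Bool) : -β * (2 * ∑ i, spin (x i)) = -(2 * β) * ∑ i, spin (x i) := by ring
  have hy (y : Fin l → Bool) : -β * (-2 * ∑ i, spin (y i)) = 2 * β * ∑ i, spin (y i) := by ring
  simp only [Fintype.sum_prod_type, Fintype.sum_bool, Hstar_true, Hstar_false, hx, hy,
    sum_exp_mul_sum_spin, sum_const, ← Finset.mul_sum, card_univ, Fintype.card_fun,
    Fintype.card_bool, Fintype.card_fin, nsmul_eq_mul, neg_neg]
  push_cast
  ring

theorem sum_exp_Hstar_ground (l : ℕ) (β : ℝ) :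
    ∑ σ ∈ univ.filter
        (fun σ : Bool × (Fin l → Bool) × (Fin l → Bool) => ∀ t, Hstar l σ ≤ Hstar l t),
      exp (-β * Hstar l σ) = 2 * 2 ^ l * exp (2 * β) ^ l := by
  have hx (x y : Fin l → Bool) :
      (Hstar l (true, x, y) = -2 * (l : ℝ)) ↔ x = fun _ => false := by
    rw [Hstar_true, ← sum_spin_eq_neg_iff]
    constructor <;> intro h <;> linarith
  have hy (x y : Fin l → Bool) :
      (Hstar l (false, x, y) = -2 * (l : ℝ)) ↔ y = fun _ => true := by
    rw [Hstar_false, ← sum_spin_eq_iff]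
    constructor <;> intro h <;> linarith
  have hexp : exp (-β * (-2 * (l : ℝ))) = exp (2 * β) ^ l := by
    rw [← Real.exp_nat_mul]
    ring_nf
  simp_rw [forall_Hstar_le_iff]
  rw [Finset.sum_congr rfl (g := fun _ => exp (2 * β) ^ l)
    fun σ hσ => by rw [(mem_filter.1 hσ).2, hexp], sum_filter]
  simp only [Fintype.sum_prod_type, Fintype.sum_bool, hx, hy]
  simp
  ring

/-- **Solution probability of the star Hamiltonian.**
At inverse temperature `βeff > 0` (with `z = 2βeff`), the Gibbs probability of
the set of ground states of `H_star` equals `1/(1 + e^{-2z})^l = (1 + e^{-4βeff})^{-l}`. -/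
theorem star_solution_probability (l : ℕ) (hl : 1 ≤ l) (βeff : ℝ) (hβ : 0 < βeff) :
    (∑ σ ∈ Finset.univ.filter
          (fun σ : Bool × (Fin l → Bool) × (Fin l → Bool) => ∀ t, Hstar l σ ≤ Hstar l t),
        Real.exp (-βeff * Hstar l σ)) /
      (∑ σ : Bool × (Fin l → Bool) × (Fin l → Bool), Real.exp (-βeff * Hstar l σ)) =
    ((1 + Real.exp (-(4 * βeff))) ^ l)⁻¹ := by
  have hfac : exp (2 * βeff) + exp (-(2 * βeff)) =
      exp (2 * βeff) * (1 + exp (-(4 * βeff))) := by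
    rw [mul_add, mul_one, ← Real.exp_add]
    ring_nf
  rw [sum_exp_Hstar_ground, sum_exp_Hstar, hfac, mul_pow]
  have hpos : 0 < 1 + exp (-(4 * βeff)) := by positivity
  field_simp
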